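/- arXiv:2211.15369 — 3 statements merged into one kernel-verified Lean document; each statement's English description precedes it below -/
import Mathlib

section
/- For every integer N ≥ 3, the index of the image of Γ(N) in PSL(2,ℤ) = SL(2,ℤ)/{±I} equals (1/2)·N³·∏_{p|N}(1 − p⁻²), where the product runs over the distinct prime divisors p of N; for N = 2 this index equals 6. -/
open Matrix CongruenceSubgroup
open scoped MatrixGroups

/-- The subgroup `{±I}` of `SL(2, ℤ)`, realised as the (cyclic) subgroup generated by `-I`. -/
def plusMinusOne : Subgroup SL(2, ℤ) := Subgroup.zpowers (-1 : SL(2, ℤ))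

instance : plusMinusOne.Normal := by
  constructor
  rintro x ⟨n, rfl⟩ g
  have h : Commute g (-1 : SL(2, ℤ)) := by
    ext i j
    simp [mul_neg, neg_mul]
  have : g * (-1 : SL(2, ℤ)) ^ n * g⁻¹ = (-1) ^ n := by
    rw [(h.zpow_right n).eq, mul_assoc, mul_inv_cancel, mul_one]
  rw [this]
  exact ⟨n, rfl⟩

/-- The image of `Γ(N)` in `PSL(2, ℤ) = SL(2, ℤ)/{±I}` under the quotient map. -/
def GammaBar (N : ℕ) : Subgroup (SL(2, ℤ) ⧸ plusMinusOne) :=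
  Subgroup.map (QuotientGroup.mk' plusMinusOne) (Gamma N)

section Counting

theorem SL2_entries_det {R : Type*} [CommRing R] (g : SpecialLinearGroup (Fin 2) R) :
    g 0 0 * g 1 1 - g 0 1 * g 1 0 = 1 :=
  (det_fin_two (g : Matrix (Fin 2) (Fin 2) R)).symm.trans g.det_coe

theorem SL2_isCoprime_bottom_row {R : Type*} [CommRing R] (g : SpecialLinearGroup (Fin 2) R) :
    IsCoprime (g 1 0) (g 1 1) :=
  ⟨-g 0 1, g 0 0, by linear_combination SL2_entries_det g⟩

/-- A determinant-one `2 × 2` matrix is determined by its (unimodular) bottom row together with one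
free parameter for the top row. -/
noncomputable def specialLinearGroupTwoEquiv (R : Type*) [CommRing R] :
    SpecialLinearGroup (Fin 2) R ≃ R × {v : R × R // IsCoprime v.1 v.2} where
  toFun g :=
    have h : IsCoprime (g 1 0) (g 1 1) := SL2_isCoprime_bottom_row g
    (g 0 0 * h.choose + g 0 1 * h.choose_spec.choose, ⟨(g 1 0, g 1 1), h⟩)
  invFun p :=
    ⟨!![p.2.2.choose_spec.choose + p.1 * p.2.1.1, -p.2.2.choose + p.1 * p.2.1.2;
        p.2.1.1, p.2.1.2], by
      rw [det_fin_two_of]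
      linear_combination p.2.2.choose_spec.choose_spec⟩
  left_inv g := by
    have h : IsCoprime (g 1 0) (g 1 1) := SL2_isCoprime_bottom_row g
    have hdet := SL2_entries_det g
    have huv := h.choose_spec.choose_spec
    ext i j
    fin_cases i <;> fin_cases j
    · change h.choose_spec.choose + (g 0 0 * h.choose + g 0 1 * h.choose_spec.choose) * g 1 0
        = g 0 0
      linear_combination g 0 0 * huv - h.choose_spec.choose * hdet
    · change -h.choose + (g 0 0 * h.choose + g 0 1 * h.choose_spec.choose) * g 1 1 = g 0 1
      linear_combination g 0 1 * huv + h.choose * hdet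
    · rfl
    · rfl
  right_inv := by
    rintro ⟨t, ⟨⟨c, d⟩, h⟩⟩
    refine Prod.ext ?_ rfl
    change (h.choose_spec.choose + t * c) * h.choose + (-h.choose + t * d) * h.choose_spec.choose
      = t
    linear_combination t * h.choose_spec.choose_spec

theorem isCoprime_prod_iff {R S : Type*} [CommRing R] [CommRing S] {x y : R × S} :
    IsCoprime x y ↔ IsCoprime x.1 y.1 ∧ IsCoprime x.2 y.2 := by
  constructor
  · exact fun h ↦ ⟨h.map (RingHom.fst R S), h.map (RingHom.snd R S)⟩
  · rintro ⟨⟨a, b, h⟩, ⟨c, d, h'⟩⟩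
    exact ⟨(a, c), (b, d), Prod.ext h h'⟩

/-- The number of unimodular pairs in a commutative ring. -/
noncomputable def cardCoprimePairs (R : Type*) [CommRing R] : ℕ :=
  Nat.card {v : R × R // IsCoprime v.1 v.2}

theorem card_specialLinearGroup_two (R : Type*) [CommRing R] :
    Nat.card (SpecialLinearGroup (Fin 2) R) = Nat.card R * cardCoprimePairs R := by
  rw [Nat.card_congr (specialLinearGroupTwoEquiv R), Nat.card_prod, cardCoprimePairs]

theorem cardCoprimePairs_congr {R S : Type*} [CommRing R] [CommRing S] (e : R ≃+* S) :
    cardCoprimePairs R = cardCoprimePairs S := by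
  refine Nat.card_congr ((Equiv.prodCongr e.toEquiv e.toEquiv).subtypeEquiv fun v ↦ ⟨?_, ?_⟩)
  · exact fun h ↦ h.map (e : R →+* S)
  · intro h
    simpa using h.map (e.symm : S →+* R)

theorem cardCoprimePairs_prod (R S : Type*) [CommRing R] [CommRing S] :
    cardCoprimePairs (R × S) = cardCoprimePairs R * cardCoprimePairs S := by
  rw [cardCoprimePairs, cardCoprimePairs, cardCoprimePairs, ← Nat.card_prod]
  refine Nat.card_congr (Equiv.trans ?_ Equiv.subtypeProdEquivProd)
  exact (Equiv.prodProdProdComm R S R S).subtypeEquiv fun v ↦ isCoprime_prod_iff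

theorem ZMod.castHom_eq_zero_of_not_isUnit {p k : ℕ} (hp : p.Prime) (hk : k ≠ 0)
    {a : ZMod (p ^ k)} (ha : ¬ IsUnit a) : ZMod.castHom (dvd_pow_self p hk) (ZMod p) a = 0 := by
  have : NeZero (p ^ k) := ⟨pow_ne_zero _ hp.ne_zero⟩
  obtain ⟨n, rfl⟩ : ∃ n : ℕ, (n : ZMod (p ^ k)) = a := ⟨a.val, ZMod.natCast_zmod_val a⟩
  rw [ZMod.isUnit_iff_coprime, Nat.coprime_pow_right_iff (Nat.pos_of_ne_zero hk),
    Nat.coprime_comm, hp.coprime_iff_not_dvd, not_not] at ha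
  rwa [map_natCast, ZMod.natCast_eq_zero_iff]

theorem ZMod.isCoprime_primePow_iff {p k : ℕ} (hp : p.Prime) (hk : k ≠ 0) {a b : ZMod (p ^ k)} :
    IsCoprime a b ↔ ¬ (¬ IsUnit a ∧ ¬ IsUnit b) := by
  constructor
  · rintro h ⟨ha, hb⟩
    have : Fact p.Prime := ⟨hp⟩
    have h' := h.map (ZMod.castHom (dvd_pow_self p hk) (ZMod p))
    rw [ZMod.castHom_eq_zero_of_not_isUnit hp hk ha,
      ZMod.castHom_eq_zero_of_not_isUnit hp hk hb, isCoprime_zero_left] at h'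
    exact not_isUnit_zero h'
  · intro h
    rw [not_and_or, not_not, not_not] at h
    rcases h with ⟨u, rfl⟩ | ⟨u, rfl⟩
    · exact ⟨↑u⁻¹, 0, by simp⟩
    · exact ⟨0, ↑u⁻¹, by simp⟩

theorem ZMod.card_not_isUnit_primePow {p k : ℕ} (hp : p.Prime) (hk : k ≠ 0) :
    Nat.card {a : ZMod (p ^ k) // ¬ IsUnit a} = p ^ (k - 1) := by
  classical
  have : NeZero (p ^ k) := ⟨pow_ne_zero _ hp.ne_zero⟩
  have h₁ : Nat.card {a : ZMod (p ^ k) // IsUnit a} = p ^ (k - 1) * (p - 1) := by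
    rw [← Nat.totient_prime_pow hp (Nat.pos_of_ne_zero hk), ← ZMod.card_units_eq_totient,
      ← Nat.card_eq_fintype_card]
    exact Nat.card_congr (Submonoid.unitsTypeEquivIsUnitSubmonoid (M := ZMod (p ^ k))).symm.toEquiv
  have h₂ : Nat.card {a : ZMod (p ^ k) // IsUnit a} + Nat.card {a : ZMod (p ^ k) // ¬ IsUnit a}
      = p ^ k := by
    rw [← Nat.card_sum, Nat.card_congr (Equiv.sumCompl _), Nat.card_zmod]
  obtain ⟨m, rfl⟩ := Nat.exists_eq_succ_of_ne_zero hk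
  obtain ⟨q, rfl⟩ := Nat.exists_eq_succ_of_ne_zero hp.ne_zero
  rw [h₁] at h₂
  simp only [Nat.succ_eq_add_one, Nat.add_sub_cancel, pow_succ (q + 1) m] at h₂ ⊢
  linarith

theorem cardCoprimePairs_zmod_primePow {p k : ℕ} (hp : p.Prime) (hk : k ≠ 0) :
    cardCoprimePairs (ZMod (p ^ k)) + (p ^ (k - 1)) ^ 2 = (p ^ k) ^ 2 := by
  classical
  have : NeZero (p ^ k) := ⟨pow_ne_zero _ hp.ne_zero⟩
  let P : ZMod (p ^ k) × ZMod (p ^ k) → Prop := fun v ↦ ¬ IsUnit v.1 ∧ ¬ IsUnit v.2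
  have h₁ : Nat.card {v // P v} = (p ^ (k - 1)) ^ 2 := by
    rw [Nat.card_congr (Equiv.subtypeProdEquivProd (p := fun a : ZMod (p ^ k) ↦ ¬ IsUnit a)
      (q := fun a : ZMod (p ^ k) ↦ ¬ IsUnit a)), Nat.card_prod,
      ZMod.card_not_isUnit_primePow hp hk, sq]
  have h₂ : cardCoprimePairs (ZMod (p ^ k)) = Nat.card {v // ¬ P v} :=
    Nat.card_congr (Equiv.subtypeEquivRight fun v ↦ ZMod.isCoprime_primePow_iff hp hk)
  rw [h₂, ← h₁, add_comm, ← Nat.card_sum, Nat.card_congr (Equiv.sumCompl P), Nat.card_prod,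
    Nat.card_zmod, sq]

theorem cardCoprimePairs_zmod {N : ℕ} (hN : N ≠ 0) :
    (cardCoprimePairs (ZMod N) : ℚ) = N ^ 2 * ∏ p ∈ N.primeFactors, (1 - ((p : ℚ)⁻¹) ^ 2) := by
  induction N using Nat.recOnPosPrimePosCoprime with
  | prime_pow p k hp hk =>
    have h := cardCoprimePairs_zmod_primePow hp hk.ne'
    rw [Nat.primeFactors_prime_pow hk.ne' hp, Finset.prod_singleton]
    have hp0 : (p : ℚ) ≠ 0 := Nat.cast_ne_zero.mpr hp.ne_zero
    obtain ⟨m, rfl⟩ := Nat.exists_eq_succ_of_ne_zero hk.ne'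
    have h' := congrArg (Nat.cast : ℕ → ℚ) h
    simp only [Nat.succ_eq_add_one, Nat.add_sub_cancel, Nat.cast_add, Nat.cast_pow] at h' ⊢
    rw [eq_sub_of_add_eq h']
    field_simp
    ring
  | zero => exact absurd rfl hN
  | one =>
    have : Nat.card {v : ZMod 1 × ZMod 1 // IsCoprime v.1 v.2} = 1 := by
      rw [Nat.card_eq_one_iff_unique]
      exact ⟨inferInstance, ⟨⟨(0, 0), 0, 0, Subsingleton.elim _ _⟩⟩⟩
    simp [cardCoprimePairs, this]
  | coprime a b ha hb hab iha ihb =>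
    rw [cardCoprimePairs_congr (ZMod.chineseRemainder hab), cardCoprimePairs_prod, Nat.cast_mul,
      iha (by lia), ihb (by lia), hab.primeFactors_mul,
      Finset.prod_union hab.disjoint_primeFactors]
    push_cast
    ring

end Counting

section Reduction

/-- A pair of integers that is unimodular modulo `N` becomes unimodular after adding a multiple of
`N` to its second entry. -/
theorem Int.exists_isCoprime_add_mul {c d n : ℤ} (hc : c ≠ 0)
    (h : ∀ p : ℕ, p.Prime → (p : ℤ) ∣ c → (p : ℤ) ∣ d → ¬ (p : ℤ) ∣ n) :
    ∃ k : ℤ, IsCoprime c (d + k * n) := by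
  classical
  let s : Finset ℕ := {p ∈ c.natAbs.primeFactors | ¬ (p : ℤ) ∣ d}
  refine ⟨∏ p ∈ s, (p : ℤ), ?_⟩
  rw [Int.isCoprime_iff_gcd_eq_one]
  by_contra hgcd
  obtain ⟨p, hp, hpdvd⟩ := Nat.exists_prime_and_dvd hgcd
  have hpc : (p : ℤ) ∣ c := (Int.natCast_dvd_natCast.mpr hpdvd).trans (Int.gcd_dvd_left _ _)
  have hps : (p : ℤ) ∣ d + (∏ p ∈ s, (p : ℤ)) * n :=
    (Int.natCast_dvd_natCast.mpr hpdvd).trans (Int.gcd_dvd_right _ _)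
  have hp' : Prime (p : ℤ) := Nat.prime_iff_prime_int.mp hp
  by_cases hpd : (p : ℤ) ∣ d
  · rcases hp'.dvd_or_dvd ((dvd_add_right hpd).mp hps) with hprod | hpn
    · obtain ⟨q, hq, hpq⟩ := (hp'.dvd_finsetProd_iff _).mp hprod
      obtain ⟨hq₁, hq₂⟩ := Finset.mem_filter.mp hq
      have : p = q := (Nat.prime_dvd_prime_iff_eq hp (Nat.prime_of_mem_primeFactors hq₁)).mp
        (Int.natCast_dvd_natCast.mp hpq)
      exact hq₂ (this ▸ hpd)
    · exact h p hp hpc hpd hpn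
  · have hmem : p ∈ s := Finset.mem_filter.mpr
      ⟨Nat.mem_primeFactors.mpr ⟨hp, Int.natCast_dvd.mp hpc, Int.natAbs_ne_zero.mpr hc⟩, hpd⟩
    have hprod : (p : ℤ) ∣ ∏ p ∈ s, (p : ℤ) := Finset.dvd_prod_of_mem (fun p : ℕ ↦ (p : ℤ)) hmem
    exact hpd ((dvd_add_left (hprod.mul_right n)).mp hps)

theorem ZMod.exists_isCoprime_lift {N : ℕ} [NeZero N] {c d : ZMod N} (h : IsCoprime c d) :
    ∃ a b : ℤ, IsCoprime a b ∧ (a : ZMod N) = c ∧ (b : ZMod N) = d := by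
  obtain ⟨a, ha0, rfl⟩ : ∃ a : ℤ, a ≠ 0 ∧ (a : ZMod N) = c := by
    have hN : 0 < N := Nat.pos_of_ne_zero (NeZero.ne N)
    exact ⟨(c.val : ℤ) + N, by lia, by simp⟩
  obtain ⟨b, rfl⟩ := ZMod.intCast_surjective d
  obtain ⟨k, hk⟩ := Int.exists_isCoprime_add_mul (c := a) (d := b) (n := N) ha0 (by
    intro p hp hpa hpb hpN
    have hpN' : p ∣ N := Int.natCast_dvd_natCast.mp hpN
    have : Fact p.Prime := ⟨hp⟩
    have h' := h.map (ZMod.castHom hpN' (ZMod p))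
    rw [map_intCast, map_intCast, (ZMod.intCast_zmod_eq_zero_iff_dvd a p).mpr hpa,
      (ZMod.intCast_zmod_eq_zero_iff_dvd b p).mpr hpb, isCoprime_zero_left] at h'
    exact not_isUnit_zero h')
  exact ⟨a, b + k * N, hk, rfl, by simp⟩

theorem SL2_reduction_surjective (N : ℕ) [NeZero N] :
    Function.Surjective
      (SpecialLinearGroup.map (n := Fin 2) (Int.castRingHom (ZMod N))) := by
  intro g
  have hg := SL2_entries_det g
  obtain ⟨c, d, hcd, hc, hd⟩ := ZMod.exists_isCoprime_lift (SL2_isCoprime_bottom_row g)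
  obtain ⟨u, v, huv⟩ := hcd
  obtain ⟨t, ht⟩ := ZMod.intCast_surjective (g 0 0 * (u : ZMod N) + g 0 1 * (v : ZMod N))
  have huv' : (u : ZMod N) * g 1 0 + v * g 1 1 = 1 := by
    rw [← hc, ← hd]
    exact_mod_cast congrArg (Int.cast : ℤ → ZMod N) huv
  refine ⟨⟨!![v + t * c, -u + t * d; c, d], ?_⟩, ?_⟩
  · rw [det_fin_two_of]
    linear_combination huv
  · ext i j
    fin_cases i <;> fin_cases j
    · change ((v + t * c : ℤ) : ZMod N) = g 0 0
      push_cast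
      rw [ht, hc]
      linear_combination g 0 0 * huv' - (v : ZMod N) * hg
    · change ((-u + t * d : ℤ) : ZMod N) = g 0 1
      push_cast
      rw [ht, hd]
      linear_combination g 0 1 * huv' + (u : ZMod N) * hg
    · exact hc
    · exact hd

theorem Gamma_index (N : ℕ) (hN : N ≠ 0) :
    ((Gamma N).index : ℚ) = N ^ 3 * ∏ p ∈ N.primeFactors, (1 - ((p : ℚ)⁻¹) ^ 2) := by
  have : NeZero N := ⟨hN⟩
  rw [Gamma, Subgroup.index_ker, MonoidHom.range_eq_top.mpr (SL2_reduction_surjective N),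
    Subgroup.card_top, card_specialLinearGroup_two, Nat.card_zmod, Nat.cast_mul,
    cardCoprimePairs_zmod hN]
  ring

end Reduction

section Projective

theorem card_plusMinusOne : Nat.card plusMinusOne = 2 := by
  rw [plusMinusOne, Nat.card_zpowers]
  refine orderOf_eq_prime (by simp) fun h ↦ ?_
  have := congrArg (fun g : SL(2, ℤ) ↦ g 0 0) h
  simp at this

theorem relIndex_mul_GammaBar_index (N : ℕ) :
    (Gamma N).relIndex plusMinusOne * (GammaBar N).index = (Gamma N).index := by
  have := Gamma_normal N
  rw [GammaBar, Subgroup.index_map, QuotientGroup.ker_mk',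
    MonoidHom.range_eq_top.mpr (QuotientGroup.mk'_surjective _), Subgroup.index_top, mul_one,
    ← Subgroup.relIndex_sup_left, Subgroup.relIndex_mul_index le_sup_left]

theorem neg_one_mem_Gamma_iff (N : ℕ) : (-1 : SL(2, ℤ)) ∈ Gamma N ↔ N ∣ 2 := by
  rw [Gamma_mem, ← ZMod.natCast_eq_zero_iff]
  simp [neg_eq_iff_add_eq_zero, one_add_one_eq_two]

theorem relIndex_plusMinusOne_of_dvd {N : ℕ} (hN : N ∣ 2) :
    (Gamma N).relIndex plusMinusOne = 1 := by
  rw [Subgroup.relIndex_eq_one, plusMinusOne, Subgroup.zpowers_le]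
  exact (neg_one_mem_Gamma_iff N).mpr hN

theorem relIndex_plusMinusOne_of_not_dvd {N : ℕ} (hN : ¬ N ∣ 2) :
    (Gamma N).relIndex plusMinusOne = 2 := by
  have hdvd : (Gamma N).relIndex plusMinusOne ∣ 2 :=
    (Subgroup.index_dvd_card _).trans card_plusMinusOne.dvd
  refine ((Nat.dvd_prime Nat.prime_two).mp hdvd).resolve_left fun h ↦ hN ?_
  rw [Subgroup.relIndex_eq_one, plusMinusOne, Subgroup.zpowers_le] at h
  exact (neg_one_mem_Gamma_iff N).mp h

end Projective

/-- **Index of the projective principal congruence subgroup.**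
For `N ≥ 3`, the index of the image of `Γ(N)` in `PSL(2, ℤ) = SL(2, ℤ)/{±I}` equals
`(1/2) · N³ · ∏_{p ∣ N} (1 − p⁻²)` (product over the distinct prime divisors of `N`),
while for `N = 2` this index equals `6`. -/
theorem GammaBar_index (N : ℕ) :
    (3 ≤ N →
      ((GammaBar N).index : ℚ) =
        (1 / 2) * N ^ 3 * ∏ p ∈ N.primeFactors, (1 - ((p : ℚ)⁻¹) ^ 2)) ∧
    (N = 2 → (GammaBar N).index = 6) := by
  constructor
  · intro hN
    have h := relIndex_mul_GammaBar_index N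
    rw [relIndex_plusMinusOne_of_not_dvd fun h ↦ absurd (Nat.le_of_dvd two_pos h) (by lia)] at h
    have h' := congrArg (Nat.cast : ℕ → ℚ) h
    rw [Nat.cast_mul, Gamma_index N (by lia)] at h'
    push_cast at h'
    linear_combination h' / 2
  · rintro rfl
    have h := relIndex_mul_GammaBar_index 2
    rw [relIndex_plusMinusOne_of_dvd dvd_rfl, one_mul] at h
    have h' := Gamma_index 2 two_ne_zero
    rw [← h, Nat.prime_two.primeFactors, Finset.prod_singleton] at h'
    norm_num at h'
    exact_mod_cast h'
end

section
/- Let γ = (a b; c d) ∈ SL(2,ℤ) with c > 0 and let τ lie in the upper half-plane ℍ. Then η((aτ + b)/(cτ + d)) = ε(a,b,c,d)·(−i(cτ + d))^{1/2}·η(τ), where ε(a,b,c,d) = exp[πi((a + d)/(12c) + s(−d, c))] and the square root is the principal branch. -/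
open Complex

/-- The Dedekind eta function `η(τ) = e^{πiτ/12} ∏_{n ≥ 1} (1 − e^{2πinτ})`
(the formula defining it on the upper half-plane, where the product converges). -/
noncomputable def dedekindEta (τ : ℂ) : ℂ :=
  Complex.exp (Real.pi * Complex.I * τ / 12) *
    ∏' n : ℕ, (1 - Complex.exp (2 * Real.pi * Complex.I * (n + 1) * τ))

/-- The Dedekind sum `s(a,b) = ∑_{ℓ=1}^{b−1} (ℓ/b)(aℓ/b − ⌊aℓ/b⌋ − 1/2)`. -/
def dedekindSum (a b : ℤ) : ℚ :=
  ∑ ℓ ∈ Finset.Ico 1 b.toNat,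
    ((ℓ : ℚ) / b) * ((a * ℓ : ℚ) / b - ⌊(a * ℓ : ℚ) / b⌋ - 1 / 2)

/-- The multiplier `ε(a,b,c,d) = exp[πi((a+d)/(12c) + s(−d,c))]` in the eta transformation law. -/
noncomputable def dedekindEps (a b c d : ℤ) : ℂ :=
  Complex.exp (Real.pi * Complex.I * (((a : ℂ) + d) / (12 * c) + (dedekindSum (-d) c : ℂ)))

section Reciprocity

lemma Nat.Coprime.sum_range_mul_mod {M : Type*} [AddCommMonoid M] {h k : ℕ}
    (hk : h.Coprime k) (g : ℕ → M) :
    ∑ l ∈ Finset.range k, g (h * l % k) = ∑ l ∈ Finset.range k, g l := by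
  have hinj : Set.InjOn (fun l ↦ h * l % k) (Finset.range k : Set ℕ) := by
    intro x hx y hy hxy
    simp only [Finset.coe_range, Set.mem_Iio] at hx hy
    have hmod : x ≡ y [MOD k] := Nat.ModEq.cancel_left_of_coprime hk.symm hxy
    exact hmod.eq_of_lt_of_lt hx hy
  have himg : (Finset.range k).image (fun l ↦ h * l % k) = Finset.range k := by
    refine Finset.eq_of_subset_of_card_le ?_ (Finset.card_image_of_injOn hinj).ge
    intro x hx
    obtain ⟨l, hl, rfl⟩ := Finset.mem_image.mp hx
    exact Finset.mem_range.mpr (Nat.mod_lt _ (Nat.zero_lt_of_lt (Finset.mem_range.mp hl)))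
  conv_rhs => rw [← himg, Finset.sum_image hinj]

lemma sum_range_natCast (n : ℕ) : ∑ l ∈ Finset.range n, (l : ℚ) = n * (n - 1) / 2 := by
  induction n with
  | zero => simp
  | succ n ih => rw [Finset.sum_range_succ, ih]; push_cast; ring

lemma sum_range_natCast_sq (n : ℕ) :
    ∑ l ∈ Finset.range n, (l : ℚ) ^ 2 = n * (n - 1) * (2 * n - 1) / 6 := by
  induction n with
  | zero => simp
  | succ n ih => rw [Finset.sum_range_succ, ih]; push_cast; ring

lemma natCast_mod_eq_sub (x k : ℕ) : ((x % k : ℕ) : ℚ) = x - k * (x / k : ℕ) := by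
  have := Nat.mod_add_div x k
  rw [eq_sub_iff_add_eq]
  exact_mod_cast this

lemma Nat.Coprime.sum_range_mul_div {h k : ℕ} (hk : h.Coprime k) (hk0 : 0 < k) :
    ∑ l ∈ Finset.range k, ((h * l / k : ℕ) : ℚ) = (h - 1) * (k - 1) / 2 := by
  have H := hk.sum_range_mul_mod (fun l ↦ (l : ℚ))
  have hk0' : (k : ℚ) ≠ 0 := by positivity
  simp only [natCast_mod_eq_sub, Nat.cast_mul, Finset.sum_sub_distrib, ← Finset.mul_sum,
    sum_range_natCast] at H
  apply mul_left_cancel₀ hk0'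
  linear_combination -H

lemma sum_range_ite_mul_lt_mul {h k l : ℕ} (hk : h.Coprime k) (hl0 : 0 < l) (hlk : l < k) :
    ∑ m ∈ Finset.range h, (if k * m < h * l then (2 * m - 1 : ℚ) else 0) =
      ((h * l / k : ℕ) : ℚ) ^ 2 - 1 := by
  have hk0 : 0 < k := hl0.trans hlk
  rcases Nat.eq_zero_or_pos h with rfl | hh
  · exfalso
    simp at hk
    omega
  have hfh : h * l / k < h := by
    rw [Nat.div_lt_iff_lt_mul hk0]
    exact Nat.mul_lt_mul_of_pos_left hlk hh
  have hfilter : (Finset.range h).filter (fun m ↦ k * m < h * l) =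
      Finset.range (h * l / k + 1) := by
    ext m
    simp only [Finset.mem_filter, Finset.mem_range, Nat.lt_succ_iff, Nat.le_div_iff_mul_le hk0]
    constructor
    · rintro ⟨-, hm⟩
      rw [mul_comm]
      exact hm.le
    · intro hm
      refine ⟨((Nat.le_div_iff_mul_le hk0).mpr hm).trans_lt hfh, ?_⟩
      rw [mul_comm] at hm
      refine lt_of_le_of_ne hm fun heq ↦ ?_
      have : k ∣ l := hk.symm.dvd_of_dvd_mul_left ⟨m, heq.symm⟩
      exact absurd (Nat.le_of_dvd hl0 this) (by omega)
  rw [← Finset.sum_filter, hfilter, Finset.sum_sub_distrib, ← Finset.mul_sum, sum_range_natCast]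
  simp only [Finset.sum_const, Finset.card_range, nsmul_eq_mul]
  push_cast
  ring

lemma sum_range_ite_mul_lt_mul_const {h k m : ℕ} (hh : 0 < h) (hmh : m < h) (hk : 0 < k) (c : ℚ) :
    ∑ l ∈ Finset.range k, (if k * m < h * l then c else 0) =
      (k - 1 - (k * m / h : ℕ)) * c := by
  have hgk : k * m / h < k := by
    rw [Nat.div_lt_iff_lt_mul hh]
    exact Nat.mul_lt_mul_of_pos_left hmh hk
  have hfilter : (Finset.range k).filter (fun l ↦ k * m < h * l) =
      Finset.Ico (k * m / h + 1) k := by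
    ext l
    simp only [Finset.mem_filter, Finset.mem_range, Finset.mem_Ico, Nat.succ_le_iff,
      Nat.div_lt_iff_lt_mul hh, mul_comm l h]
    tauto
  rw [← Finset.sum_filter, hfilter, Finset.sum_const, Nat.card_Ico, nsmul_eq_mul,
    Nat.cast_sub hgk]
  push_cast
  ring

lemma sum_range_mul_div_sq {h k : ℕ} (hk : h.Coprime k) (hh : 0 < h) (hk0 : 0 < k) :
    ∑ l ∈ Finset.range k, ((h * l / k : ℕ) : ℚ) ^ 2 =
      (k - 1) * (h - 1) ^ 2 + (h - 1) * (k - 1) / 2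
        - 2 * ∑ m ∈ Finset.range h, (m : ℚ) * (k * m / h : ℕ) := by
  have hswap := Finset.sum_comm (s := Finset.range k) (t := Finset.range h)
    (f := fun l m ↦ if k * m < h * l then (2 * m - 1 : ℚ) else 0)
  have hleft : ∑ l ∈ Finset.range k, ∑ m ∈ Finset.range h,
      (if k * m < h * l then (2 * m - 1 : ℚ) else 0) =
      ∑ l ∈ Finset.range k, ((h * l / k : ℕ) : ℚ) ^ 2 - (k - 1) := by
    obtain ⟨n, rfl⟩ := Nat.exists_eq_add_of_lt hk0
    simp only [zero_add] at *
    rw [Finset.sum_range_succ', Finset.sum_range_succ', Finset.sum_congr rfl fun l hl ↦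
      sum_range_ite_mul_lt_mul hk l.succ_pos (Nat.succ_lt_succ (Finset.mem_range.mp hl))]
    simp [Finset.sum_sub_distrib]
  have hright : ∑ m ∈ Finset.range h, ∑ l ∈ Finset.range k,
      (if k * m < h * l then (2 * m - 1 : ℚ) else 0) =
      (k - 1) * h * (h - 2) - 2 * ∑ m ∈ Finset.range h, (m : ℚ) * (k * m / h : ℕ) +
        (h - 1) * (k - 1) / 2 := by
    rw [Finset.sum_congr rfl fun m hm ↦
      sum_range_ite_mul_lt_mul_const hh (Finset.mem_range.mp hm) hk0 _]
    have hsum := hk.symm.sum_range_mul_div hh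
    have hexp : ∀ m : ℕ, ((k : ℚ) - 1 - (k * m / h : ℕ)) * (2 * m - 1) =
        2 * (k - 1) * m - (k - 1) - 2 * (m * (k * m / h : ℕ)) + (k * m / h : ℕ) := by
      intro m; ring
    simp only [hexp, Finset.sum_add_distrib, Finset.sum_sub_distrib, ← Finset.mul_sum, hsum,
      sum_range_natCast, Finset.sum_const, Finset.card_range, nsmul_eq_mul]
    ring
  linear_combination hright - hleft + hswap

lemma sum_range_mul_div_reciprocity {h k : ℕ} (hk : h.Coprime k) (hh : 0 < h) (hk0 : 0 < k) :
    12 * h * ∑ l ∈ Finset.range k, (l : ℚ) * (h * l / k : ℕ) +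
      12 * k * ∑ m ∈ Finset.range h, (m : ℚ) * (k * m / h : ℕ) =
      (h - 1) * (k - 1) * (8 * h * k - h - k - 1 : ℚ) := by
  have H := hk.sum_range_mul_mod (fun l ↦ (l : ℚ) ^ 2)
  have hexp : ∀ l : ℕ, (h * l - k * (h * l / k : ℕ) : ℚ) ^ 2 =
      h ^ 2 * l ^ 2 - 2 * h * k * (l * (h * l / k : ℕ)) + k ^ 2 * ((h * l / k : ℕ) : ℚ) ^ 2 := by
    intro l; ring
  simp only [natCast_mod_eq_sub, Nat.cast_mul, hexp, Finset.sum_add_distrib,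
    Finset.sum_sub_distrib, ← Finset.mul_sum, sum_range_natCast_sq,
    sum_range_mul_div_sq hk hh hk0] at H
  have hk0' : (k : ℚ) ≠ 0 := by positivity
  apply mul_left_cancel₀ hk0'
  linear_combination -6 * H

lemma dedekindSum_natCast (h : ℕ) {k : ℕ} (hk0 : 0 < k) :
    dedekindSum h k = h * (k - 1) * (2 * k - 1) / (6 * k) - (k - 1) / 4
      - (∑ l ∈ Finset.range k, (l : ℚ) * (h * l / k : ℕ)) / k := by
  have hk0' : (k : ℚ) ≠ 0 := by positivity
  have hrange : dedekindSum h k = ∑ l ∈ Finset.range k,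
      ((h / k ^ 2 : ℚ) * (l : ℚ) ^ 2 - 1 / k * (l * (h * l / k : ℕ)) - 1 / (2 * k) * l) := by
    rw [Finset.range_eq_Ico, Finset.sum_eq_sum_Ico_succ_bot hk0, dedekindSum]
    simp only [Int.toNat_natCast, Int.cast_natCast, Nat.cast_zero]
    simp only [mul_zero, Nat.zero_div, Nat.cast_zero, ne_eq, OfNat.ofNat_ne_zero,
      not_false_eq_true, zero_pow, sub_zero, zero_add]
    refine Finset.sum_congr rfl fun l _ ↦ ?_
    have hfloor : ⌊((h : ℚ) * l / k)⌋ = ((h * l / k : ℕ) : ℤ) := by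
      have := Rat.floor_intCast_div_natCast ((h * l : ℕ) : ℤ) k
      push_cast at this ⊢
      exact this
    rw [hfloor, Int.cast_natCast]
    field_simp
  rw [hrange, Finset.sum_sub_distrib, Finset.sum_sub_distrib, ← Finset.mul_sum, ← Finset.mul_sum,
    ← Finset.mul_sum, sum_range_natCast, sum_range_natCast_sq]
  field_simp
  ring

/-- **Reciprocity law for Dedekind sums.** -/
lemma dedekindSum_reciprocity {h k : ℕ} (hk : h.Coprime k) (hh : 0 < h) (hk0 : 0 < k) :
    dedekindSum h k + dedekindSum k h =
      -1 / 4 + (h / k + k / h + 1 / (h * k) : ℚ) / 12 := by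
  have H := sum_range_mul_div_reciprocity hk hh hk0
  have hk0' : (k : ℚ) ≠ 0 := by positivity
  have hh' : (h : ℚ) ≠ 0 := by positivity
  rw [dedekindSum_natCast h hk0, dedekindSum_natCast k hh]
  generalize ∑ l ∈ Finset.range k, (l : ℚ) * (h * l / k : ℕ) = x at *
  generalize ∑ l ∈ Finset.range h, (l : ℚ) * (k * l / h : ℕ) = y at *
  field_simp
  linear_combination -24 * H

lemma dedekindSum_neg {a b : ℤ} (hab : IsCoprime a b) :
    dedekindSum (-a) b = -dedekindSum a b := by
  rw [dedekindSum, dedekindSum, ← Finset.sum_neg_distrib]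
  refine Finset.sum_congr rfl fun l hl ↦ ?_
  have hl' : (1 : ℤ) ≤ l ∧ (l : ℤ) < b := by
    rw [Finset.mem_Ico] at hl
    omega
  have hb : (b : ℚ) ≠ 0 := by
    have : b ≠ 0 := by omega
    exact_mod_cast this
  have hfloor : ⌊((-a : ℤ) * l : ℚ) / b⌋ = -⌊(a * l : ℚ) / b⌋ - 1 := by
    rw [Int.cast_neg, neg_mul, neg_div, Int.floor_neg]
    suffices ⌈(a * l : ℚ) / b⌉ = ⌊(a * l : ℚ) / b⌋ + 1 by omega
    rw [Int.ceil_eq_floor_add_one_iff_notMem]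
    rintro ⟨n, hn⟩
    rw [eq_div_iff hb] at hn
    have hdvd : b ∣ a * l := ⟨n, by exact_mod_cast hn.symm.trans (mul_comm _ _)⟩
    have := Int.le_of_dvd (by omega) (hab.symm.dvd_of_dvd_mul_left hdvd)
    omega
  rw [hfloor]
  push_cast
  ring

lemma dedekindSum_add_mul_right (a q : ℤ) {b : ℤ} (hb : b ≠ 0) :
    dedekindSum (a + q * b) b = dedekindSum a b := by
  refine Finset.sum_congr rfl fun l _ ↦ ?_
  have hb' : (b : ℚ) ≠ 0 := by exact_mod_cast hb
  have harg : ((a + q * b : ℤ) * l : ℚ) / b = (a * l : ℚ) / b + (q * l : ℤ) := by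
    push_cast
    field_simp
  rw [harg, Int.floor_add_intCast]
  push_cast
  ring

end Reciprocity

section Eta

lemma dedekindEta_eq_eta (τ : ℂ) : dedekindEta τ = ModularForm.eta τ := by
  simp only [dedekindEta, ModularForm.eta, ModularForm.eta_q_eq_cexp]
  rw [Function.Periodic.qParam]
  congr 2
  push_cast
  ring

lemma dedekindEta_add_intCast (τ : ℂ) (n : ℤ) :
    dedekindEta (τ + n) = Complex.exp (Real.pi * I * n / 12) * dedekindEta τ := by
  have hfactor : ∀ k : ℕ, Complex.exp (2 * Real.pi * I * (k + 1) * (τ + n)) =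
      Complex.exp (2 * Real.pi * I * (k + 1) * τ) := by
    intro k
    rw [Complex.exp_eq_exp_iff_exists_int]
    exact ⟨(k + 1) * n, by push_cast; ring⟩
  simp only [dedekindEta, hfactor]
  rw [← mul_assoc, ← Complex.exp_add]
  congr 2
  ring

lemma log_neg_I_mul {z : ℂ} (hz : 0 < z.im) : log (-I * z) = log z - Real.pi / 2 * I := by
  have hz0 : z ≠ 0 := by rintro rfl; simp at hz
  rw [Complex.log_mul (by simp) hz0, log_neg_I]
  · ring
  · rw [arg_neg_I]
    have h0 : 0 ≤ z.arg := arg_nonneg_iff.mpr hz.le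
    have h1 := arg_le_pi z
    constructor <;> linarith [Real.pi_pos]

lemma cpow_half_eq_exp {z : ℂ} (hz : z ≠ 0) : z ^ ((1 : ℂ) / 2) = Complex.exp (log z / 2) := by
  rw [cpow_def_of_ne_zero hz]
  ring_nf

lemma dedekindEta_neg_one_div {τ : ℂ} (hτ : 0 < τ.im) :
    dedekindEta (-1 / τ) = (-I * τ) ^ ((1 : ℂ) / 2) * dedekindEta τ := by
  have hτ0 : τ ≠ 0 := by rintro rfl; simp at hτ
  have h := ModularForm.eta_comp_eq_csqrt_I_inv (x := τ) hτ
  simp only [Function.comp_apply, Pi.smul_apply, Pi.mul_apply, smul_eq_mul, Complex.sqrt,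
    ← one_div (2 : ℂ)] at h
  rw [dedekindEta_eq_eta, dedekindEta_eq_eta, h, ← mul_assoc, cpow_half_eq_exp hτ0,
    cpow_half_eq_exp I_ne_zero, cpow_half_eq_exp (by simpa using hτ0), log_neg_I_mul hτ, log_I,
    ← Complex.exp_neg, ← Complex.exp_add]
  congr 2
  ring

lemma cpow_half_mul_cpow_half {z w v : ℂ} (hz : 0 < z.re) (hw : 0 < w.re) (hv : 0 < v.im)
    (h : z * w = v) :
    z ^ ((1 : ℂ) / 2) * w ^ ((1 : ℂ) / 2) =
      Complex.exp (Real.pi * I / 4) * (-I * v) ^ ((1 : ℂ) / 2) := by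
  have hz0 : z ≠ 0 := by rintro rfl; simp at hz
  have hw0 : w ≠ 0 := by rintro rfl; simp at hw
  have hv0 : v ≠ 0 := by rintro rfl; simp at hv
  have hlog : log v = log z + log w := by
    rw [← h, Complex.log_mul hz0 hw0]
    have h1 := abs_lt.mp (abs_arg_lt_pi_div_two_iff.mpr (Or.inl hz))
    have h2 := abs_lt.mp (abs_arg_lt_pi_div_two_iff.mpr (Or.inl hw))
    constructor <;> linarith
  rw [cpow_half_eq_exp hz0, cpow_half_eq_exp hw0, cpow_half_eq_exp (by simpa using hv0),
    log_neg_I_mul hv, hlog, ← Complex.exp_add, ← Complex.exp_add]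
  congr 1
  ring

lemma dedekindEps_add_mul (a b c d q : ℤ) (hc : c ≠ 0) :
    dedekindEps a (b + a * q) c (d + c * q) =
      Complex.exp (Real.pi * I * q / 12) * dedekindEps a b c d := by
  have hsum : dedekindSum (-(d + c * q)) c = dedekindSum (-d) c := by
    rw [← dedekindSum_add_mul_right (-d) (-q) hc]
    ring_nf
  have hc' : (c : ℂ) ≠ 0 := by exact_mod_cast hc
  rw [dedekindEps, dedekindEps, hsum, ← Complex.exp_add]
  congr 1
  push_cast
  field_simp
  ring

lemma dedekindEps_mul_S {a b c d : ℤ} (hdet : a * d - b * c = 1) (hc : 0 < c) (hd : 0 < d) :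
    dedekindEps b (-a) d (-c) * Complex.exp (Real.pi * I / 4) = dedekindEps a b c d := by
  have hdc : IsCoprime d c := ⟨a, -b, by linear_combination hdet⟩
  obtain ⟨k, rfl⟩ := Int.eq_ofNat_of_zero_le hc.le
  obtain ⟨h, rfl⟩ := Int.eq_ofNat_of_zero_le hd.le
  have hrec := dedekindSum_reciprocity (Nat.isCoprime_iff_coprime.mp hdc)
    (by exact_mod_cast hd) (by exact_mod_cast hc)
  have hk : (k : ℂ) ≠ 0 := by exact_mod_cast hc.ne'
  have hh : (h : ℂ) ≠ 0 := by exact_mod_cast hd.ne'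
  have hrec' := congrArg (fun x : ℚ ↦ (x : ℂ)) hrec
  have hdet' : (a * h - b * k : ℂ) = 1 := by exact_mod_cast hdet
  push_cast at hrec'
  rw [dedekindEps, dedekindEps, dedekindSum_neg hdc, neg_neg, ← Complex.exp_add]
  congr 1
  push_cast
  rw [show ((dedekindSum k h : ℚ) : ℂ) = -(dedekindSum h k : ℚ) +
    (-1 / 4 + (h / k + k / h + (a * h - b * k) / (h * k)) / 12) by
      rw [hdet']; linear_combination hrec']
  field_simp
  ring

end Eta

/-- **Transformation law of the Dedekind eta function** (Apostol).
Let `γ = (a b; c d) ∈ SL(2, ℤ)` with `c > 0` and let `τ` lie in the upper half-plane. Then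
`η((aτ+b)/(cτ+d)) = ε(a,b,c,d) · (−i(cτ+d))^{1/2} · η(τ)`, where the square root is the
principal branch (complex `cpow` with exponent `1/2`). -/
theorem dedekindEta_transform (a b c d : ℤ) (hdet : a * d - b * c = 1) (hc : 0 < c)
    (τ : ℂ) (hτ : 0 < τ.im) :
    dedekindEta (((a : ℂ) * τ + b) / ((c : ℂ) * τ + d)) =
      dedekindEps a b c d * (-Complex.I * ((c : ℂ) * τ + d)) ^ ((1 : ℂ) / 2) *
        dedekindEta τ := by
  induction hn : c.toNat using Nat.strong_induction_on generalizing a b c d τ with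
  | _ n ih =>
  subst hn
  wlog hd : 0 ≤ d ∧ d < c generalizing b d τ
  · have hmod := Int.emod_add_mul_ediv d c
    have H := this (b - a * (d / c)) (d % c)
      (by linear_combination hdet + a * hmod) (τ + (d / c : ℤ)) (by simpa using hτ)
      ⟨Int.emod_nonneg _ hc.ne', Int.emod_lt_of_pos _ hc⟩
    have heps := dedekindEps_add_mul a (b - a * (d / c)) c (d % c) (d / c) hc.ne'
    rw [sub_add_cancel, hmod] at heps
    have hmod' : ((d % c : ℤ) : ℂ) + c * (d / c : ℤ) = d := by exact_mod_cast hmod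
    have hnum : (a : ℂ) * (τ + (d / c : ℤ)) + (b - a * (d / c) : ℤ) = a * τ + b := by
      push_cast; ring
    have hden : (c : ℂ) * (τ + (d / c : ℤ)) + (d % c : ℤ) = c * τ + d := by
      rw [← hmod']; ring
    rw [hnum, hden, dedekindEta_add_intCast] at H
    rw [H, heps]
    ring
  have hτ0 : τ ≠ 0 := by rintro rfl; simp at hτ
  rcases hd.1.eq_or_lt with rfl | hd0
  · have hc1 : c = 1 := by
      refine Int.eq_one_of_dvd_one hc.le ⟨-b, by linear_combination -hdet⟩
    subst hc1
    have hb : b = -1 := by linarith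
    subst hb
    have harg : ((a : ℂ) * τ + (-1 : ℤ)) / ((1 : ℤ) * τ + (0 : ℤ)) = -1 / τ + a := by
      simp only [Int.cast_one, Int.cast_zero, Int.cast_neg, one_mul, add_zero]
      field_simp
      ring
    rw [harg, dedekindEta_add_intCast, dedekindEta_neg_one_div hτ, dedekindEps]
    simp only [neg_zero, show dedekindSum 0 1 = 0 from rfl]
    push_cast
    rw [← mul_assoc]
    congr 3
    · ring
    · ring
  · have hτ' : 0 < (-1 / τ).im := by
      rw [neg_div, one_div, neg_im, inv_im, neg_div, neg_neg]
      exact div_pos hτ (normSq_pos.mpr hτ0)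
    have H := ih d.toNat (by omega) b (-a) d (-c) (by linear_combination hdet) hd0 (-1 / τ) hτ' rfl
    have him : 0 < ((c : ℂ) * τ + d).im := by
      have : (0 : ℝ) < c := by exact_mod_cast hc
      simpa using mul_pos this hτ
    have hne : (c : ℂ) * τ + d ≠ 0 := by intro h; simp [h] at him
    have harg : ((b : ℂ) * (-1 / τ) + (-a : ℤ)) / (d * (-1 / τ) + (-c : ℤ)) =
        (a * τ + b) / (c * τ + d) := by
      have : (d : ℂ) * (-1 / τ) + (-c : ℤ) = -(c * τ + d) / τ := by
        push_cast; field_simp; ring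
      rw [this]
      push_cast
      field_simp
      ring
    have hsqrt := cpow_half_mul_cpow_half (z := -I * (d * (-1 / τ) + (-c : ℤ))) (w := -I * τ)
      (v := c * τ + d) (by
        have : (0 : ℝ) < d := by exact_mod_cast hd0
        have := mul_pos this hτ'
        simpa using this) (by simpa using hτ) him (by
        push_cast
        field_simp
        linear_combination (-(c : ℂ) * τ - d) * I_sq)
    rw [harg, dedekindEta_neg_one_div hτ] at H
    rw [H, ← dedekindEps_mul_S hdet hc hd0]
    linear_combination dedekindEps b (-a) d (-c) * dedekindEta τ * hsqrt
end

section
/- For every positive integer N, the number ν₂(Γ₀(N)) of Γ₀(N)-inequivalent elliptic points of order 2 equals ∏_{p|N}(1 + (−1/p)) if 4 ∤ N, and equals 0 if 4 | N; here the product runs over the distinct prime divisors p of N and (−1/p) = +1 if p ≡ 1 (mod 4), −1 if p ≡ 3 (mod 4), and 0 if p = 2. -/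
open Matrix CongruenceSubgroup UpperHalfPlane
open scoped MatrixGroups

/-- The natural homomorphism `SL(2, ℤ) →* PSL(2, ℝ)`, obtained by composing the inclusion
`SL(2, ℤ) → SL(2, ℝ)` with the quotient by the centre (`PSL(2, ℝ) = SL(2, ℝ)/{±I}`). -/
noncomputable def toPSL : SL(2, ℤ) →* (SL(2, ℝ) ⧸ Subgroup.center SL(2, ℝ)) :=
  (QuotientGroup.mk' (Subgroup.center SL(2, ℝ))).comp
    (Matrix.SpecialLinearGroup.map (Int.castRingHom ℝ))

/-- A point `z ∈ ℍ` is an elliptic point of order `n` for a subgroup `Γ'` of `SL(2, ℤ)` if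
the stabiliser of `z` in the image of `Γ'` in `PSL(2, ℝ)` — equivalently, the image in
`PSL(2, ℝ)` of the stabiliser `Γ' ⊓ Stab(z)` (since `−I` acts trivially on `ℍ`) — is a
cyclic group of order `n`. -/
def IsEllipticPointOfOrder (Γ' : Subgroup SL(2, ℤ)) (n : ℕ) (z : ℍ) : Prop :=
  IsCyclic (Subgroup.map toPSL (Γ' ⊓ MulAction.stabilizer SL(2, ℤ) z)) ∧
  Nat.card (Subgroup.map toPSL (Γ' ⊓ MulAction.stabilizer SL(2, ℤ) z)) = n

/-- `ν_n(Γ')`: the number of `Γ'`-orbits of elliptic points of order `n` in `ℍ`. -/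
noncomputable def numEllipticOrbits (Γ' : Subgroup SL(2, ℤ)) (n : ℕ) : ℕ :=
  Nat.card {O : Set ℍ // ∃ z : ℍ, IsEllipticPointOfOrder Γ' n z ∧
    O = {w : ℍ | ∃ γ ∈ Γ', γ • z = w}}

/-- The symbol `(−1/p)`: it is `+1` if `p ≡ 1 (mod 4)`, `−1` if `p ≡ 3 (mod 4)`, and `0`
if `p = 2` (more generally, if `p` is even). -/
def legendreNegOne (p : ℕ) : ℤ :=
  if p % 4 = 1 then 1 else if p % 4 = 3 then -1 else 0

/-- `z = (a + i) / c`, where `c * m = a ^ 2 + 1`; equivalently, `z` is the root in `ℍ` of the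
quadratic form `c X ^ 2 - 2 a X + m` of discriminant `-4`. -/
def IsGaussianPoint (z : ℍ) (a c m : ℤ) : Prop :=
  (c : ℝ) * z.re = a ∧ (c : ℝ) * z.im = 1 ∧ c * m = a ^ 2 + 1

lemma det_entries (g : SL(2, ℤ)) : g 0 0 * g 1 1 - g 0 1 * g 1 0 = 1 := by
  rw [← Matrix.det_fin_two, g.det_coe]

lemma smul_eq_iff_re_im (g : SL(2, ℤ)) (z w : ℍ) :
    g • z = w ↔
      (g 0 0 : ℝ) * z.re + g 0 1 = (g 1 0 * z.re + g 1 1) * w.re - g 1 0 * z.im * w.im ∧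
      (g 0 0 : ℝ) * z.im = (g 1 0 * z.re + g 1 1) * w.im + g 1 0 * z.im * w.re := by
  have hden : ((g 1 0 : ℂ) * z + g 1 1) ≠ 0 := by
    have := UpperHalfPlane.denom_ne_zero (g : GL (Fin 2) ℝ) z
    rwa [ModularGroup.denom_apply] at this
  rw [UpperHalfPlane.ext_iff, coe_specialLinearGroup_apply]
  simp only [algebraMap_int_eq, eq_intCast, Complex.ofReal_intCast]
  rw [div_eq_iff hden, Complex.ext_iff]
  simp only [Complex.add_re, Complex.mul_re, Complex.add_im, Complex.mul_im, Complex.intCast_re,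
    Complex.intCast_im, coe_re, coe_im]
  constructor <;> rintro ⟨h1, h2⟩ <;> constructor <;> linarith

namespace IsGaussianPoint

variable {z w : ℍ} {a c m a' c' m' : ℤ}

lemma pos (h : IsGaussianPoint z a c m) : 0 < c := by
  have h1 : 0 < (c : ℝ) * z.im := by rw [h.2.1]; exact one_pos
  exact_mod_cast (pos_iff_pos_of_mul_pos h1).2 z.im_pos

lemma eq_of_coords (hz : IsGaussianPoint z a c m) (hw : IsGaussianPoint w a c m') : z = w := by
  have hc : (c : ℝ) ≠ 0 := by exact_mod_cast hz.pos.ne'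
  refine UpperHalfPlane.ext_re_im ?_ ?_
  · exact mul_left_cancel₀ hc (hz.1.trans hw.1.symm)
  · exact mul_left_cancel₀ hc (hz.2.1.trans hw.2.1.symm)

lemma coords_unique (h : IsGaussianPoint z a c m) (h' : IsGaussianPoint z a' c' m') :
    a = a' ∧ c = c' := by
  have hc : (c : ℝ) = c' := mul_right_cancel₀ z.im_pos.ne' (h.2.1.trans h'.2.1.symm)
  refine ⟨?_, by exact_mod_cast hc⟩
  have : (a : ℝ) = a' := by rw [← h.1, ← h'.1, hc]
  exact_mod_cast this

lemma exists_point (hc : 0 < c) (hm : c * m = a ^ 2 + 1) : ∃ z : ℍ, IsGaussianPoint z a c m := by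
  have hc' : (0 : ℝ) < c := by exact_mod_cast hc
  refine ⟨⟨⟨a / c, 1 / c⟩, by simpa using hc⟩, ?_, ?_, hm⟩
  · exact mul_div_cancel₀ _ hc'.ne'
  · exact mul_div_cancel₀ _ hc'.ne'

protected lemma smul (h : IsGaussianPoint z a c m) (g : SL(2, ℤ)) :
    IsGaussianPoint (g • z)
      (g 0 0 * g 1 0 * m + (g 0 0 * g 1 1 + g 0 1 * g 1 0) * a + g 0 1 * g 1 1 * c)
      (g 1 0 ^ 2 * m + 2 * g 1 0 * g 1 1 * a + g 1 1 ^ 2 * c)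
      (g 0 0 ^ 2 * m + 2 * g 0 0 * g 0 1 * a + g 0 1 ^ 2 * c) := by
  have hdet := det_entries g
  have hc := h.pos
  obtain ⟨hx, hy, hm⟩ := h
  have hm' : (g 1 0 ^ 2 * m + 2 * g 1 0 * g 1 1 * a + g 1 1 ^ 2 * c) *
      (g 0 0 ^ 2 * m + 2 * g 0 0 * g 0 1 * a + g 0 1 ^ 2 * c) =
      (g 0 0 * g 1 0 * m + (g 0 0 * g 1 1 + g 0 1 * g 1 0) * a + g 0 1 * g 1 1 * c) ^ 2 + 1 := by
    linear_combination (g 0 0 * g 1 1 - g 0 1 * g 1 0) ^ 2 * hm +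
      (g 0 0 * g 1 1 - g 0 1 * g 1 0 + 1) * hdet
  have hc' : 0 < g 1 0 ^ 2 * m + 2 * g 1 0 * g 1 1 * a + g 1 1 ^ 2 * c := by
    have h1 : 0 ≤ g 1 0 ^ 2 * m + 2 * g 1 0 * g 1 1 * a + g 1 1 ^ 2 * c := by
      refine nonneg_of_mul_nonneg_right (b := _) (a := c) ?_ hc
      have : c * (g 1 0 ^ 2 * m + 2 * g 1 0 * g 1 1 * a + g 1 1 ^ 2 * c) =
          (g 1 0 * a + g 1 1 * c) ^ 2 + g 1 0 ^ 2 := by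
        linear_combination g 1 0 ^ 2 * hm
      rw [this]; positivity
    refine h1.lt_of_ne fun h0 ↦ ?_
    rw [← h0] at hm'
    nlinarith [sq_nonneg (g 0 0 * g 1 0 * m + (g 0 0 * g 1 1 + g 0 1 * g 1 0) * a
      + g 0 1 * g 1 1 * c)]
  obtain ⟨w, hw⟩ := exists_point hc' hm'
  suffices g • z = w by rwa [this]
  obtain ⟨hu, hv, -⟩ := hw
  have hcR : (c : ℝ) ≠ 0 := by exact_mod_cast hc.ne'
  have hcR' := (Int.cast_pos (R := ℝ).2 hc').ne'
  have hmR : (c : ℝ) * m = a ^ 2 + 1 := by exact_mod_cast hm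
  have hdetR : (g 0 0 : ℝ) * g 1 1 - g 0 1 * g 1 0 = 1 := by exact_mod_cast hdet
  rw [smul_eq_iff_re_im]
  rw [eq_div_of_mul_eq hcR ((mul_comm _ _).trans hx),
    eq_div_of_mul_eq hcR ((mul_comm _ _).trans hy),
    eq_div_of_mul_eq hcR' ((mul_comm _ _).trans hu),
    eq_div_of_mul_eq hcR' ((mul_comm _ _).trans hv)]
  push_cast at hcR' ⊢
  generalize (g 0 0 : ℝ) = p at *
  generalize (g 0 1 : ℝ) = q at *
  generalize (g 1 0 : ℝ) = r at *
  generalize (g 1 1 : ℝ) = s at *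
  generalize hC : r ^ 2 * (m : ℝ) + 2 * r * s * a + s ^ 2 * c = C at hcR' ⊢
  constructor
  · field_simp
    linear_combination -r * (p * s - q * r) * hmR - r * hdetR - (p * a + q * c) * hC
  · field_simp
    linear_combination (r * a + s * c) * hdetR - p * hC

lemma exists_smul_I_eq (h : IsGaussianPoint z a c m) : ∃ g : SL(2, ℤ), g • I = z := by
  obtain ⟨g, hg⟩ := ModularGroup.exists_smul_mem_fd z
  have hw := h.smul g
  generalize g 0 0 * g 1 0 * m + (g 0 0 * g 1 1 + g 0 1 * g 1 0) * a + g 0 1 * g 1 1 * c = a' at hw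
  generalize g 1 0 ^ 2 * m + 2 * g 1 0 * g 1 1 * a + g 1 1 ^ 2 * c = c' at hw
  generalize g 0 0 ^ 2 * m + 2 * g 0 0 * g 0 1 * a + g 0 1 ^ 2 * c = m' at hw
  have hpos := hw.pos
  obtain ⟨hx, hy, hm⟩ := id hw
  obtain ⟨h1, h2⟩ := hg
  rw [Complex.normSq_apply, coe_re, coe_im] at h1
  have hcR : (0 : ℝ) < c' := by exact_mod_cast hpos
  have e1 : 2 * |a'| ≤ c' := by
    have : 2 * |(a' : ℝ)| ≤ c' := by
      rw [← hx, abs_mul, abs_of_pos hcR]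
      nlinarith
    exact_mod_cast this
  have e2 : c' ^ 2 ≤ a' ^ 2 + 1 := by
    have : (c' : ℝ) ^ 2 ≤ a' ^ 2 + 1 := by
      have : (a' : ℝ) ^ 2 + 1 = c' ^ 2 * ((g • z).re * (g • z).re + (g • z).im * (g • z).im) := by
        rw [← hx]
        linear_combination -(c' * (g • z).im + 1) * hy
      rw [this]
      nlinarith [sq_nonneg (c' : ℝ)]
    exact_mod_cast this
  have e3 : a' = 0 := by
    rw [← sq_abs a'] at e2
    rw [← abs_eq_zero]
    nlinarith [abs_nonneg a']
  have e4 : c' = 1 := by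
    subst e3
    nlinarith
  have hI : IsGaussianPoint I 0 1 1 := by simp [IsGaussianPoint]
  subst e3 e4
  exact ⟨g⁻¹, by rw [inv_smul_eq_iff]; exact (hw.eq_of_coords hI).symm⟩

/-- Gaussian points of level `N` with congruent numerators are `Γ₀(N)`-equivalent. -/
lemma exists_mem_Gamma0_smul_eq {N : ℕ} (hz : IsGaussianPoint z a c m)
    (hw : IsGaussianPoint w a' c' m') (hc : (c : ZMod N) = 0) (hc' : (c' : ZMod N) = 0)
    (ha : (a : ZMod N) = a') : ∃ g ∈ Gamma0 N, g • z = w := by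
  obtain ⟨g, rfl⟩ := hz.exists_smul_I_eq
  obtain ⟨h, rfl⟩ := hw.exists_smul_I_eq
  have hI : IsGaussianPoint I 0 1 1 := by simp [IsGaussianPoint]
  have row (g : SL(2, ℤ)) {a c m : ℤ} (hz : IsGaussianPoint (g • I) a c m)
      (hc : (c : ZMod N) = 0) : (g 1 1 : ZMod N) = - a * g 1 0 := by
    obtain ⟨rfl, rfl⟩ := hz.coords_unique (hI.smul g)
    have hdet : (g 0 0 : ZMod N) * g 1 1 - g 0 1 * g 1 0 = 1 := by
      exact_mod_cast congrArg (Int.cast : ℤ → ZMod N) (det_entries g)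
    push_cast at hc ⊢
    linear_combination - (g 1 1 : ZMod N) * hdet + g 0 0 * hc
  have h1 := row g hz hc
  have h2 := row h hw hc'
  refine ⟨h * g⁻¹, ?_, by rw [mul_smul, inv_smul_smul]⟩
  rw [Gamma0_mem]
  have : (h * g⁻¹) 1 0 = h 1 0 * g 1 1 - h 1 1 * g 1 0 := by
    rw [Matrix.SpecialLinearGroup.coe_mul, Matrix.SpecialLinearGroup.coe_inv,
      Matrix.adjugate_fin_two, Matrix.mul_apply, Fin.sum_univ_two]
    simp
    ring
  rw [this]
  push_cast
  rw [h1, h2, ha]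
  ring

lemma cast_eq_of_smul_eq {N : ℕ} (hz : IsGaussianPoint z a c m) (hw : IsGaussianPoint w a' c' m')
    (hc : (c : ZMod N) = 0) {g : SL(2, ℤ)} (hg : g ∈ Gamma0 N) (h : g • z = w) :
    (a : ZMod N) = a' := by
  subst h
  obtain ⟨rfl, -⟩ := hw.coords_unique (hz.smul g)
  rw [Gamma0_mem] at hg
  have hdet : (g 0 0 : ZMod N) * g 1 1 - g 0 1 * g 1 0 = 1 := by
    exact_mod_cast congrArg (Int.cast : ℤ → ZMod N) (det_entries g)
  push_cast
  rw [hg, hc] at *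
  linear_combination -(a : ZMod N) * hdet

end IsGaussianPoint

lemma eq_one_or_neg_one_of_entries (g : SL(2, ℤ)) (h01 : g 0 1 = 0) (h10 : g 1 0 = 0) :
    g = 1 ∨ g = -1 := by
  have hdet := det_entries g
  rw [h01, zero_mul, sub_zero] at hdet
  rcases Int.mul_eq_one_iff_eq_one_or_neg_one.1 hdet with ⟨h1, h2⟩ | ⟨h1, h2⟩
  · left
    ext i j
    fin_cases i <;> fin_cases j <;> simp [*]
  · right
    ext i j
    fin_cases i <;> fin_cases j <;> simp [*]

lemma toPSL_eq_one_iff (g : SL(2, ℤ)) : toPSL g = 1 ↔ g = 1 ∨ g = -1 := by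
  have : toPSL g = 1 ↔ Matrix.SpecialLinearGroup.map (Int.castRingHom ℝ) g ∈
      Subgroup.center SL(2, ℝ) := by
    rw [toPSL, MonoidHom.comp_apply, QuotientGroup.mk'_apply, QuotientGroup.eq_one_iff]
  rw [this, Matrix.SpecialLinearGroup.mem_center_iff]
  constructor
  · rintro ⟨r, -, h⟩
    have h01 := congrFun₂ h 0 1
    have h10 := congrFun₂ h 1 0
    simp at h01 h10
    exact eq_one_or_neg_one_of_entries g (by exact_mod_cast h01.symm) (by exact_mod_cast h10.symm)
  · rintro (rfl | rfl)
    · exact ⟨1, by simp, by simp⟩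
    · refine ⟨-1, by simp, ?_⟩
      ext i j
      fin_cases i <;> fin_cases j <;> simp

lemma trace_eq_zero_of_sq (g : SL(2, ℤ)) (h : toPSL g ≠ 1) (h2 : toPSL g ^ 2 = 1) :
    g 0 0 + g 1 1 = 0 := by
  by_contra ht
  refine h ((toPSL_eq_one_iff g).2 ?_)
  rw [← map_pow, toPSL_eq_one_iff, sq] at h2
  have key : (g * g) 0 1 = 0 ∧ (g * g) 1 0 = 0 := by
    rcases h2 with h2 | h2 <;> simp [h2]
  simp only [Matrix.SpecialLinearGroup.coe_mul, Matrix.mul_apply, Fin.sum_univ_two] at key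
  apply eq_one_or_neg_one_of_entries
  · refine (mul_eq_zero.1 ?_).resolve_right ht
    linear_combination key.1
  · refine (mul_eq_zero.1 ?_).resolve_right ht
    linear_combination key.2

lemma isGaussianPoint_of_smul_eq_self {g : SL(2, ℤ)} {z : ℍ} (ht : g 0 0 + g 1 1 = 0)
    (hz : g • z = z) (hc : 0 < g 1 0) : IsGaussianPoint z (g 0 0) (g 1 0) (-g 0 1) := by
  have hdet := det_entries g
  have hdetR : (g 0 0 : ℝ) * g 1 1 - g 0 1 * g 1 0 = 1 := by exact_mod_cast hdet
  have htR : (g 1 1 : ℝ) = -g 0 0 := by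
    exact_mod_cast (by linarith : g 1 1 = -g 0 0)
  have hcR : (0 : ℝ) < g 1 0 := by exact_mod_cast hc
  rw [smul_eq_iff_re_im, htR] at hz
  obtain ⟨h1, h2⟩ := hz
  have hx : (g 1 0 : ℝ) * z.re = g 0 0 := by
    apply mul_right_cancel₀ z.im_pos.ne'
    linear_combination -h2 / 2
  refine ⟨hx, ?_, ?_⟩
  · rw [htR] at hdetR
    have h3 : ((g 1 0 : ℝ) * z.im) ^ 2 = 1 := by
      linear_combination g 1 0 * h1 + hdetR + (g 1 0 * z.re - g 0 0) * hx
    have := mul_pos hcR z.im_pos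
    nlinarith
  · rw [(by linarith : g 1 1 = -g 0 0)] at hdet
    linear_combination hdet

lemma eq_of_smul_gaussianPoint {z : ℍ} {a c m : ℤ} (h : IsGaussianPoint z a c m) {g : SL(2, ℤ)}
    (hg : g • z = z) : (g = 1 ∨ g = -1) ∨
      (g 1 0 = c ∧ g 0 0 = a ∧ g 1 1 = -a ∧ g 0 1 = -m) ∨
      (g 1 0 = -c ∧ g 0 0 = -a ∧ g 1 1 = a ∧ g 0 1 = m) := by
  have hc := h.pos
  have hcR : (c : ℝ) ≠ 0 := by exact_mod_cast hc.ne'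
  have hdet := det_entries g
  obtain ⟨hx, hy, hm⟩ := h
  rw [smul_eq_iff_re_im] at hg
  obtain ⟨h1, h2⟩ := hg
  have hmR : (c : ℝ) * m = a ^ 2 + 1 := by exact_mod_cast hm
  have e1 : c * (g 0 0 - g 1 1) = 2 * a * g 1 0 := by
    have : (c : ℝ) * (g 0 0 - g 1 1) = 2 * a * g 1 0 := by
      linear_combination c * c * h2 + (2 * c * g 1 0 * z.re - c * (g 0 0 - g 1 1)) * hy +
        2 * g 1 0 * hx
    exact_mod_cast this
  have e2 : c * g 0 1 = - m * g 1 0 := by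
    have e1R : (c : ℝ) * (g 0 0 - g 1 1) = 2 * a * g 1 0 := by exact_mod_cast e1
    have : (c : ℝ) * g 0 1 = - m * g 1 0 := by
      apply mul_left_cancel₀ hcR
      rw [eq_div_of_mul_eq hcR ((mul_comm _ _).trans hx),
        eq_div_of_mul_eq hcR ((mul_comm _ _).trans hy)] at h1
      field_simp at h1
      linear_combination h1 - a * e1R + g 1 0 * hmR
    exact_mod_cast this
  have e3 : c ^ 2 * (g 0 0 + g 1 1) ^ 2 + (2 * g 1 0) ^ 2 = 4 * c ^ 2 := by
    linear_combination 4 * c ^ 2 * hdet + (c * (g 0 0 - g 1 1) + 2 * a * g 1 0) * e1 +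
      4 * c * g 1 0 * e2 - 4 * g 1 0 ^ 2 * hm
  have e4 : (g 0 0 + g 1 1) ^ 2 ≤ 4 := by
    by_contra! hlt
    nlinarith [sq_nonneg (2 * g 1 0), pow_pos hc 2]
  have b1 : g 0 0 + g 1 1 ≤ 2 := by nlinarith
  have b2 : -2 ≤ g 0 0 + g 1 1 := by nlinarith
  have key : g 1 0 = 0 ∨ g 0 0 + g 1 1 = 0 := by
    generalize g 0 0 + g 1 1 = t at *
    generalize g 1 0 = r at *
    have no3 : (2 * r) ^ 2 ≠ 3 * c ^ 2 := by
      intro h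
      have hs : IsSquare (3 : ℚ) := ⟨2 * r / c, by
        have : (c : ℚ) ≠ 0 := by exact_mod_cast hc.ne'
        field_simp
        have h' : (2 * r : ℚ) ^ 2 = 3 * c ^ 2 := by exact_mod_cast h
        linear_combination -h'⟩
      obtain ⟨k, hk⟩ : IsSquare 3 := Rat.isSquare_natCast_iff.1 (by exact_mod_cast hs)
      have : k < 2 := by nlinarith
      interval_cases k <;> omega
    interval_cases t
    · left; nlinarith
    · exact absurd (by linarith) no3
    · right; rfl
    · exact absurd (by linarith) no3
    · left; nlinarith
  rcases key with h0 | h0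
  · left
    apply eq_one_or_neg_one_of_entries _ _ h0
    rw [h0, mul_zero] at e2
    exact (mul_eq_zero.1 e2).resolve_left hc.ne'
  · right
    have h11 : g 1 1 = - g 0 0 := by linarith
    rw [h0] at e3
    rw [h11] at e1 ⊢
    have : (g 1 0 - c) * (g 1 0 + c) = 0 := by linarith
    rcases mul_eq_zero.1 this with h | h
    · left
      have hr : g 1 0 = c := by linarith
      rw [hr] at e1 e2
      have h00 : g 0 0 = a := mul_left_cancel₀ hc.ne' (by linarith)
      exact ⟨hr, h00, by rw [h00], mul_left_cancel₀ hc.ne' (by linarith)⟩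
    · right
      have hr : g 1 0 = -c := by linarith
      rw [hr] at e1 e2
      have h00 : g 0 0 = -a := mul_left_cancel₀ hc.ne' (by linarith)
      exact ⟨hr, h00, by rw [h00, neg_neg], mul_left_cancel₀ hc.ne' (by linarith)⟩

lemma isEllipticPointOfOrder_two_iff (N : ℕ) (z : ℍ) :
    IsEllipticPointOfOrder (Gamma0 N) 2 z ↔
      ∃ a c m : ℤ, IsGaussianPoint z a c m ∧ (c : ZMod N) = 0 := by
  constructor
  · rintro ⟨-, hcard⟩
    obtain ⟨⟨x, g, ⟨hgN, hgz⟩, rfl⟩, hx⟩ : ∃ x : Subgroup.map toPSL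
        (Gamma0 N ⊓ MulAction.stabilizer SL(2, ℤ) z), x ≠ 1 := by
      have : Nontrivial (Subgroup.map toPSL (Gamma0 N ⊓ MulAction.stabilizer SL(2, ℤ) z)) :=
        by
        have := Nat.finite_of_card_ne_zero (hcard.trans_ne two_ne_zero)
        exact Finite.one_lt_card_iff_nontrivial.1 (one_lt_two.trans_eq hcard.symm)
      exact exists_ne 1
    have hx2 := pow_card_eq_one' (x := (⟨toPSL g, g, ⟨hgN, hgz⟩, rfl⟩ : Subgroup.map toPSL
        (Gamma0 N ⊓ MulAction.stabilizer SL(2, ℤ) z)))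
    rw [hcard] at hx2
    have ht := trace_eq_zero_of_sq g (fun h ↦ hx (Subtype.ext h)) (congrArg Subtype.val hx2)
    have hgz : g • z = z := hgz
    have hgN : (g 1 0 : ZMod N) = 0 := hgN
    rcases lt_trichotomy (g 1 0) 0 with h | h | h
    · have := isGaussianPoint_of_smul_eq_self (g := -g) (z := z) (by simp; linarith)
        (by rw [ModularGroup.SL_neg_smul, hgz]) (by simpa using h)
      exact ⟨_, _, _, this, by simpa using hgN⟩
    · have := det_entries g
      rw [h, eq_neg_of_add_eq_zero_right ht] at this
      nlinarith [sq_nonneg (g 0 0)]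
    · exact ⟨_, _, _, isGaussianPoint_of_smul_eq_self ht hgz h, hgN⟩
  · rintro ⟨a, c, m, h, hc⟩
    obtain ⟨g, h00, h01, h10, h11⟩ : ∃ g : SL(2, ℤ),
        g 0 0 = a ∧ g 0 1 = -m ∧ g 1 0 = c ∧ g 1 1 = -a :=
      ⟨⟨!![a, -m; c, -a], by rw [Matrix.det_fin_two_of]; linear_combination h.2.2⟩,
        rfl, rfl, rfl, rfl⟩
    have hgz : g • z = z := by
      have hcR : (c : ℝ) ≠ 0 := by exact_mod_cast h.pos.ne'
      have hmR : (c : ℝ) * m = a ^ 2 + 1 := by exact_mod_cast h.2.2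
      rw [smul_eq_iff_re_im]
      rw [eq_div_of_mul_eq hcR ((mul_comm _ _).trans h.1),
        eq_div_of_mul_eq hcR ((mul_comm _ _).trans h.2.1)]
      rw [h00, h01, h10, h11]
      push_cast
      constructor
      · field_simp
        linear_combination -hmR
      · field_simp
        ring
    have hg1 : toPSL g ≠ 1 := by
      rw [Ne, toPSL_eq_one_iff]
      have h10 : g 1 0 ≠ 0 := h10.trans_ne h.pos.ne'
      rintro (h | h) <;> exact h10 (by simp [h])
    have hgg : g * g = -1 := by
      have := h.2.2
      ext i j
      fin_cases i <;> fin_cases j <;> simp [Matrix.mul_apply, Fin.sum_univ_two, *] <;> linarith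
    have hord : orderOf (toPSL g) = 2 := by
      refine orderOf_eq_prime ?_ hg1
      rw [← map_pow, toPSL_eq_one_iff, sq, hgg]
      exact .inr rfl
    have hmap : Subgroup.map toPSL (Gamma0 N ⊓ MulAction.stabilizer SL(2, ℤ) z) =
        Subgroup.zpowers (toPSL g) := by
      apply le_antisymm
      · rintro _ ⟨k, ⟨-, hk⟩, rfl⟩
        have hk : k • z = z := hk
        have hneg : toPSL (-g) = toPSL g := by
          rw [← neg_one_mul, map_mul, (toPSL_eq_one_iff (-1)).2 (.inr rfl), one_mul]
        rcases eq_of_smul_gaussianPoint h hk with h | ⟨h1, h2, h3, h4⟩ | ⟨h1, h2, h3, h4⟩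
        · rw [(toPSL_eq_one_iff k).2 h]
          exact one_mem _
        · have : k = g := by
            ext i j
            fin_cases i <;> fin_cases j <;> simp [*]
          rw [this]
          exact Subgroup.mem_zpowers _
        · have : k = -g := by
            ext i j
            fin_cases i <;> fin_cases j <;> simp [*]
          rw [this, hneg]
          exact Subgroup.mem_zpowers _
      · rw [Subgroup.zpowers_le]
        exact ⟨g, ⟨by rwa [← h10] at hc, hgz⟩, rfl⟩
    rw [IsEllipticPointOfOrder, hmap]
    exact ⟨inferInstance, by rw [Nat.card_zpowers, hord]⟩

/-- The number of square roots of `-1` modulo `N`. -/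
noncomputable def numSqrtNegOne (N : ℕ) : ℕ :=
  Nat.card {x : ZMod N // x ^ 2 = -1}

lemma numEllipticOrbits_Gamma0_two {N : ℕ} (hN : 0 < N) :
    numEllipticOrbits (Gamma0 N) 2 = numSqrtNegOne N := by
  have hex (x : {x : ZMod N // x ^ 2 = -1}) :
      ∃ (z : ℍ) (a m : ℤ), (a : ZMod N) = x ∧ IsGaussianPoint z a N m := by
    obtain ⟨a, ha⟩ := ZMod.intCast_surjective x.1
    have hdvd : (N : ℤ) ∣ a ^ 2 + 1 := by
      rw [← ZMod.intCast_zmod_eq_zero_iff_dvd]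
      push_cast
      rw [ha, x.2, neg_add_cancel]
    obtain ⟨m, hm⟩ := hdvd
    obtain ⟨z, hz⟩ := IsGaussianPoint.exists_point (c := N) (by exact_mod_cast hN) hm.symm
    exact ⟨z, a, m, ha, hz⟩
  choose z a m ha hz using hex
  have hN0 : (((N : ℕ) : ℤ) : ZMod N) = 0 := by simp
  symm
  refine Nat.card_eq_of_bijective (fun x ↦ ⟨{w : ℍ | ∃ γ ∈ Gamma0 N, γ • z x = w}, z x,
    (isEllipticPointOfOrder_two_iff N _).2 ⟨_, _, _, hz x, hN0⟩, rfl⟩) ⟨?_, ?_⟩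
  · intro x y hxy
    have hy : z y ∈ {w : ℍ | ∃ γ ∈ Gamma0 N, γ • z x = w} := by
      have h : {w : ℍ | ∃ γ ∈ Gamma0 N, γ • z x = w} = {w : ℍ | ∃ γ ∈ Gamma0 N, γ • z y = w} :=
        congrArg Subtype.val hxy
      rw [h]
      exact ⟨1, one_mem _, one_smul _ _⟩
    obtain ⟨g, hg, h⟩ := hy
    apply Subtype.ext
    rw [← ha x, ← ha y]
    exact (hz x).cast_eq_of_smul_eq (hz y) hN0 hg h
  · rintro ⟨_, w, hw, rfl⟩
    obtain ⟨b, c, n, hb, hc⟩ := (isEllipticPointOfOrder_two_iff N _).1 hw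
    have hsq : (b : ZMod N) ^ 2 = -1 := by
      have := congrArg (Int.cast : ℤ → ZMod N) hb.2.2
      push_cast at this
      rw [hc] at this
      linear_combination -this
    obtain ⟨g, hg, h⟩ := (hz ⟨b, hsq⟩).exists_mem_Gamma0_smul_eq hb hN0 hc (ha _)
    refine ⟨⟨b, hsq⟩, Subtype.ext ?_⟩
    ext v
    constructor
    · rintro ⟨k, hk, rfl⟩
      exact ⟨k * g⁻¹, mul_mem hk (inv_mem hg), by rw [← h, mul_smul, inv_smul_smul]⟩
    · rintro ⟨k, hk, rfl⟩
      exact ⟨k * g, mul_mem hk hg, by rw [← h, mul_smul]⟩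

lemma numSqrtNegOne_mul {a b : ℕ} (h : a.Coprime b) :
    numSqrtNegOne (a * b) = numSqrtNegOne a * numSqrtNegOne b := by
  rw [numSqrtNegOne, numSqrtNegOne, numSqrtNegOne, ← Nat.card_prod]
  refine Nat.card_congr (((ZMod.chineseRemainder h).toEquiv.subtypeEquiv
    (q := fun x ↦ x.1 ^ 2 = -1 ∧ x.2 ^ 2 = -1) fun x ↦ ?_).trans (Equiv.subtypeProdEquivProd
      (p := fun x : ZMod a ↦ x ^ 2 = -1) (q := fun x : ZMod b ↦ x ^ 2 = -1)))
  rw [← (ZMod.chineseRemainder h).injective.eq_iff, map_pow, map_neg, map_one, Prod.ext_iff]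
  rfl

lemma numSqrtNegOne_eq_zero_of_dvd {d n : ℕ} (hdn : d ∣ n) (hd : ∀ x : ZMod d, x ^ 2 ≠ -1) :
    numSqrtNegOne n = 0 := by
  have : IsEmpty {x : ZMod n // x ^ 2 = -1} := ⟨fun x ↦ hd (ZMod.castHom hdn (ZMod d) x.1) (by
    rw [← map_pow, x.2, map_neg, map_one])⟩
  exact Nat.card_of_isEmpty

lemma numSqrtNegOne_prime_pow {p n : ℕ} (hp : p.Prime) (h4 : p % 4 = 1) (hn : 0 < n) :
    numSqrtNegOne (p ^ n) = 2 := by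
  have := Fact.mk hp
  obtain ⟨k, rfl⟩ := Nat.exists_eq_succ_of_ne_zero hn.ne'
  have hp5 : 5 ≤ p := by have := hp.two_le; omega
  have hpZ : Prime (p : ℤ) := Nat.prime_iff_prime_int.1 hp
  obtain ⟨y, hy⟩ := ZMod.exists_sq_eq_neg_one_iff (p := p).2 (by omega)
  obtain ⟨y, rfl⟩ := ZMod.intCast_surjective y
  have hdvd : (p : ℤ) ∣ y ^ 2 - (-1) := by
    rw [← ZMod.intCast_zmod_eq_zero_iff_dvd]
    push_cast
    rw [sq, ← hy]
    ring
  have hlift := dvd_sub_pow_of_dvd_sub hdvd k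
  rw [Odd.neg_one_pow ((hp.odd_of_ne_two (by omega)).pow), ← pow_mul, mul_comm, pow_mul] at hlift
  set i : ℤ := y ^ p ^ k with hi
  have hisq : (i : ZMod (p ^ (k + 1))) ^ 2 = -1 := by
    have := (ZMod.intCast_zmod_eq_zero_iff_dvd (i ^ 2 - (-1)) (p ^ (k + 1))).2
      (by exact_mod_cast hlift)
    push_cast at this
    linear_combination this
  have hpi : ¬ (p : ℤ) ∣ 2 * i := by
    intro h
    rcases hpZ.dvd_or_dvd h with h | h
    · have := Int.le_of_dvd two_pos h
      omega
    · have h1 : (p : ℤ) ∣ i ^ 2 - (-1) := (dvd_pow_self _ k.succ_ne_zero).trans hlift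
      have h2 : (p : ℤ) ∣ 1 := by
        have := dvd_sub h1 (h.mul_right i)
        ring_nf at this
        simpa using this
      exact hpZ.not_dvd_one h2
  have hset : {x : ZMod (p ^ (k + 1)) | x ^ 2 = -1} =
      {(i : ZMod (p ^ (k + 1))), -(i : ZMod (p ^ (k + 1)))} := by
    ext x
    simp only [Set.mem_ofPred_eq, Set.mem_insert_iff, Set.mem_singleton_iff]
    constructor
    · intro hx
      obtain ⟨x, rfl⟩ := ZMod.intCast_surjective x
      have hd : (p : ℤ) ^ (k + 1) ∣ (x - i) * (x + i) := by
        have := (ZMod.intCast_zmod_eq_zero_iff_dvd ((x - i) * (x + i)) (p ^ (k + 1))).1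
          (by push_cast; linear_combination hx - hisq)
        exact_mod_cast this
      by_cases h1 : (p : ℤ) ∣ x - i
      · left
        have h2 : ¬ (p : ℤ) ∣ x + i := fun h2 ↦ hpi (by
          have := dvd_sub h2 h1
          ring_nf at this ⊢
          exact this)
        have h3 := hpZ.pow_dvd_of_dvd_mul_right _ h2 hd
        have := (ZMod.intCast_zmod_eq_zero_iff_dvd (x - i) (p ^ (k + 1))).2 (by exact_mod_cast h3)
        push_cast at this
        linear_combination this
      · right
        have h3 := hpZ.pow_dvd_of_dvd_mul_left _ h1 hd
        have := (ZMod.intCast_zmod_eq_zero_iff_dvd (x + i) (p ^ (k + 1))).2 (by exact_mod_cast h3)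
        push_cast at this
        linear_combination this
    · rintro (rfl | rfl)
      · exact hisq
      · rw [neg_sq, hisq]
  have hne : (i : ZMod (p ^ (k + 1))) ≠ -i := by
    intro h
    have := (ZMod.intCast_zmod_eq_zero_iff_dvd (2 * i) (p ^ (k + 1))).1
      (by push_cast; linear_combination h)
    exact hpi ((dvd_pow_self _ k.succ_ne_zero).trans (by exact_mod_cast this))
  have hcard : numSqrtNegOne (p ^ (k + 1)) = {x : ZMod (p ^ (k + 1)) | x ^ 2 = -1}.ncard := rfl
  rw [hcard, hset, Set.ncard_pair hne]

lemma numSqrtNegOne_eq (N : ℕ) (hN : 0 < N) :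
    (numSqrtNegOne N : ℤ) =
      if 4 ∣ N then 0 else ∏ p ∈ N.primeFactors, (1 + legendreNegOne p) := by
  induction N using Nat.recOnPosPrimePosCoprime with
  | zero => exact absurd hN (lt_irrefl 0)
  | one =>
    have : numSqrtNegOne 1 = 1 :=
      Nat.card_eq_one_iff_unique.2 ⟨inferInstance, ⟨⟨0, Subsingleton.elim _ _⟩⟩⟩
    simp [this]
  | prime_pow p n hp hn =>
    have := Fact.mk hp
    rw [Nat.primeFactors_prime_pow hn.ne' hp, Finset.prod_singleton]
    rcases hp.eq_two_or_odd with rfl | hodd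
    · obtain rfl | hn2 : n = 1 ∨ 2 ≤ n := by omega
      · have : numSqrtNegOne 2 = 1 := by
          rw [numSqrtNegOne, Nat.card_eq_fintype_card]
          decide
        simp [this, legendreNegOne]
      · have hd : 4 ∣ 2 ^ n := pow_dvd_pow 2 hn2
        rw [if_pos hd, numSqrtNegOne_eq_zero_of_dvd hd (by decide), Nat.cast_zero]
    · have h4 : ¬ 4 ∣ p ^ n := fun h ↦ by
        have h2 : 2 ∣ p := Nat.prime_two.dvd_of_dvd_pow ((by norm_num : 2 ∣ 4).trans h)
        omega
      rw [if_neg h4]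
      obtain h | h : p % 4 = 1 ∨ p % 4 = 3 := by omega
      · rw [numSqrtNegOne_prime_pow hp h hn]
        simp [legendreNegOne, h]
      · rw [numSqrtNegOne_eq_zero_of_dvd (dvd_pow_self p hn.ne')]
        · simp [legendreNegOne, h]
        · intro x hx
          exact ZMod.exists_sq_eq_neg_one_iff.1 ⟨x, by rw [← hx, sq]⟩ h
  | coprime a b ha hb hab iha ihb =>
    have hdvd : 4 ∣ a * b ↔ 4 ∣ a ∨ 4 ∣ b :=
      hab.isPrimePow_dvd_mul (Nat.prime_two.isPrimePow.pow two_ne_zero)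
    rw [numSqrtNegOne_mul hab, Nat.cast_mul, iha (by omega), ihb (by omega),
      hab.primeFactors_mul, Finset.prod_union hab.disjoint_primeFactors]
    by_cases h1 : 4 ∣ a <;> by_cases h2 : 4 ∣ b <;> simp [hdvd, h1, h2]

/-- **Number of elliptic points of order 2 for `Γ₀(N)`.**
For every positive integer `N`, the number `ν₂(Γ₀(N))` of `Γ₀(N)`-inequivalent elliptic
points of order `2` equals `∏_{p ∣ N} (1 + (−1/p))` if `4 ∤ N`, and equals `0` if `4 ∣ N`;
the product runs over the distinct prime divisors of `N`. -/
theorem nu2_Gamma0 (N : ℕ) (hN : 0 < N) :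
    (numEllipticOrbits (Gamma0 N) 2 : ℤ) =
      if 4 ∣ N then 0 else ∏ p ∈ N.primeFactors, (1 + legendreNegOne p) := by
  rw [numEllipticOrbits_Gamma0_two hN, numSqrtNegOne_eq N hN]
end
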